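/- There exists a unique family of functions H_r : ℍ → ℂ indexed by r ∈ ℤ/6ℤ such that for all τ ∈ ℍ and all z ∈ ℂ with z ∉ ℤτ + ℤ, −2 Ψ_{1,1}(τ,z) φ^{(3)}_1(τ,z) = −12 μ_{3,0}(τ,z) + ∑_{r mod 6} H_r(τ) θ_{3,r}(τ,z). -/

import Mathlib

noncomputable section

open Complex

/-- `q = e^{2πiτ}` (also used for `u = e^{2πiz}`). -/
def qq (τ : ℂ) : ℂ := exp (2 * ↑Real.pi * I * τ)

/-- The Dedekind eta function `η(τ) = q^{1/24} ∏_{n≥1} (1 − qⁿ)`. -/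
def dedekindEta (τ : ℂ) : ℂ := exp (2 * ↑Real.pi * I * τ / 24) * ∏' n : ℕ, (1 - qq τ ^ (n + 1))

/-- `θ₁(τ,z) = −i q^{1/8} u^{1/2} ∏_{n≥1} (1 − u⁻¹qⁿ⁻¹)(1 − uqⁿ)(1 − qⁿ)`. -/
def theta1 (τ z : ℂ) : ℂ :=
  -I * exp (2 * ↑Real.pi * I * τ / 8) * exp (↑Real.pi * I * z) *
    ∏' n : ℕ, ((1 - (qq z)⁻¹ * qq τ ^ n) * (1 - qq z * qq τ ^ (n + 1)) * (1 - qq τ ^ (n + 1)))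

/-- `θ₂(τ,z) = q^{1/8} u^{1/2} ∏_{n≥1} (1 + u⁻¹qⁿ⁻¹)(1 + uqⁿ)(1 − qⁿ)`. -/
def theta2 (τ z : ℂ) : ℂ :=
  exp (2 * ↑Real.pi * I * τ / 8) * exp (↑Real.pi * I * z) *
    ∏' n : ℕ, ((1 + (qq z)⁻¹ * qq τ ^ n) * (1 + qq z * qq τ ^ (n + 1)) * (1 - qq τ ^ (n + 1)))

/-- `θ₃(τ,z) = ∏_{n≥1} (1 + u⁻¹qⁿ⁻¹ᐟ²)(1 + uqⁿ⁻¹ᐟ²)(1 − qⁿ)`. -/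
def theta3 (τ z : ℂ) : ℂ :=
  ∏' n : ℕ, ((1 + (qq z)⁻¹ * exp (2 * ↑Real.pi * I * τ * ((n : ℂ) + 1 / 2))) *
    (1 + qq z * exp (2 * ↑Real.pi * I * τ * ((n : ℂ) + 1 / 2))) * (1 - qq τ ^ (n + 1)))

/-- `θ₄(τ,z) = ∏_{n≥1} (1 − u⁻¹qⁿ⁻¹ᐟ²)(1 − uqⁿ⁻¹ᐟ²)(1 − qⁿ)`. -/
def theta4 (τ z : ℂ) : ℂ :=
  ∏' n : ℕ, ((1 - (qq z)⁻¹ * exp (2 * ↑Real.pi * I * τ * ((n : ℂ) + 1 / 2))) *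
    (1 - qq z * exp (2 * ↑Real.pi * I * τ * ((n : ℂ) + 1 / 2))) * (1 - qq τ ^ (n + 1)))

/-- `Ψ_{1,1}(τ,z) = −i θ₁(τ,2z) η(τ)³ / θ₁(τ,z)²`. -/
def Psi11 (τ z : ℂ) : ℂ := -I * theta1 τ (2 * z) * dedekindEta τ ^ 3 / theta1 τ z ^ 2

/-- `μ_{m,0}(τ,z) = ∑_{k∈ℤ} u^{2km} q^{mk²} (uq^k + 1)/(uq^k − 1)`. -/
def mu (m : ℕ) (τ z : ℂ) : ℂ :=
  ∑' k : ℤ, qq z ^ (2 * k * (m : ℤ)) * qq τ ^ ((m : ℤ) * k ^ 2) *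
    ((qq z * qq τ ^ k + 1) / (qq z * qq τ ^ k - 1))

/-- The index `m` theta function `θ_{m,r}(τ,z) = ∑_{k∈ℤ} u^{2mk+r} q^{(2mk+r)²/(4m)}`,
which depends only on `r` modulo `2m`. -/
def thetam (m : ℕ) (r : ℤ) (τ z : ℂ) : ℂ :=
  ∑' k : ℤ, qq z ^ (2 * (m : ℤ) * k + r) *
    exp (2 * ↑Real.pi * I * τ * (((2 * (m : ℤ) * k + r : ℤ) : ℂ) ^ 2 / (4 * (m : ℂ))))

/-- `φ^{(3)}_1(τ,z) = 2(θ₃²θ₄²/(θ₃(τ,0)²θ₄(τ,0)²) + θ₄²θ₂²/(θ₄(τ,0)²θ₂(τ,0)²)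
  + θ₂²θ₃²/(θ₂(τ,0)²θ₃(τ,0)²))` (arguments `(τ,z)` suppressed in the numerators). -/
def phi31 (τ z : ℂ) : ℂ :=
  2 * (theta3 τ z ^ 2 * theta4 τ z ^ 2 / (theta3 τ 0 ^ 2 * theta4 τ 0 ^ 2) +
    theta4 τ z ^ 2 * theta2 τ z ^ 2 / (theta4 τ 0 ^ 2 * theta2 τ 0 ^ 2) +
    theta2 τ z ^ 2 * theta3 τ z ^ 2 / (theta2 τ 0 ^ 2 * theta3 τ 0 ^ 2))

section Auxiliary

open Filter Topology

/-- The infinite product `∏_{n ≥ 0} (1 - a qⁿ)`. -/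
def qPochInf (q a : ℂ) : ℂ := ∏' n : ℕ, (1 - a * q ^ n)

lemma summable_norm_neg_mul_pow {q : ℂ} (hq : ‖q‖ < 1) (a : ℂ) :
    Summable fun n : ℕ ↦ ‖-(a * q ^ n)‖ := by
  simpa using (summable_geometric_of_lt_one (norm_nonneg q) hq).mul_left ‖a‖

lemma multipliable_qPochInf {q : ℂ} (hq : ‖q‖ < 1) (a : ℂ) :
    Multipliable fun n : ℕ ↦ 1 - a * q ^ n := by
  simpa [sub_eq_add_neg] using multipliable_one_add_of_summable (summable_norm_neg_mul_pow hq a)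

lemma qPochInf_eq_mul {q : ℂ} (hq : ‖q‖ < 1) (a : ℂ) :
    qPochInf q a = (1 - a) * qPochInf q (a * q) := by
  have h : (fun n : ℕ ↦ 1 - a * q ^ (n + 1)) = fun n : ℕ ↦ 1 - a * q * q ^ n := by
    ext n; ring
  rw [qPochInf, tprod_eq_zero_mul' (h ▸ multipliable_qPochInf hq (a * q)), h]
  simp [qPochInf]

lemma qPochInf_ne_zero {q : ℂ} (hq : ‖q‖ < 1) {a : ℂ} (ha : ∀ n : ℕ, a * q ^ n ≠ 1) :
    qPochInf q a ≠ 0 := by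
  have := tprod_one_add_ne_zero_of_summable (f := fun n : ℕ ↦ -(a * q ^ n))
    (fun n ↦ by rw [← sub_eq_add_neg]; exact sub_ne_zero.mpr (ha n).symm)
    (summable_norm_neg_mul_pow hq a)
  simpa [qPochInf, sub_eq_add_neg] using this

lemma differentiable_qPochInf {q : ℂ} (hq : ‖q‖ < 1) : Differentiable ℂ (qPochInf q) := by
  intro a
  have hU : IsOpen (Metric.ball (0 : ℂ) (‖a‖ + 1)) := Metric.isOpen_ball
  have h := Summable.hasProdLocallyUniformlyOn_nat_one_add (K := Metric.ball (0 : ℂ) (‖a‖ + 1))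
    (f := fun n w ↦ -(w * q ^ n)) hU
    ((summable_geometric_of_lt_one (norm_nonneg q) hq).mul_left (‖a‖ + 1))
    (.of_forall fun n w hw ↦ by
      rw [norm_neg, norm_mul, norm_pow]
      gcongr
      exact (mem_ball_zero_iff.mp hw).le) (fun n ↦ by fun_prop)
  have hd := h.differentiableOn (.of_forall fun _ ↦ by
    simpa [Finset.prod_fn] using DifferentiableOn.finsetProd (fun _ _ ↦ by fun_prop)) hU
  have := hd.differentiableAt (hU.mem_nhds (by simp : a ∈ Metric.ball (0 : ℂ) (‖a‖ + 1)))
  simpa only [← sub_eq_add_neg] using! this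

/-- The product `∏_{n ≥ 1} (1 - u⁻¹ qⁿ⁻¹)(1 - u qⁿ)`, vanishing to first order exactly
on `q ^ ℤ`. -/
def thetaProd (q u : ℂ) : ℂ := qPochInf q u⁻¹ * qPochInf q (u * q)

lemma thetaProd_mul_left {q u : ℂ} (hq0 : q ≠ 0) (hq : ‖q‖ < 1) (hu : u ≠ 0) :
    thetaProd q (q * u) = -(q * u)⁻¹ * thetaProd q u := by
  have h1 := qPochInf_eq_mul hq (q * u)⁻¹
  have h2 := qPochInf_eq_mul hq (u * q)
  rw [show (q * u)⁻¹ * q = u⁻¹ by field_simp] at h1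
  rw [thetaProd, thetaProd, h1, h2, show u * q * q = q * u * q by ring]
  field_simp
  ring

lemma thetaProd_eq_mul {q u : ℂ} (hq : ‖q‖ < 1) :
    thetaProd q u = (1 - u⁻¹) * (qPochInf q (u⁻¹ * q) * qPochInf q (u * q)) := by
  rw [thetaProd, qPochInf_eq_mul hq u⁻¹]; ring

lemma differentiableAt_thetaProd {q u : ℂ} (hq : ‖q‖ < 1) (hu : u ≠ 0) :
    DifferentiableAt ℂ (thetaProd q) u := by
  have h := differentiable_qPochInf hq
  exact ((h _).comp u (differentiableAt_inv hu)).mul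
    ((h _).comp (f := fun u ↦ u * q) u (by fun_prop))

lemma thetaProd_ne_zero {q u : ℂ} (hq : ‖q‖ < 1) (hu : u ≠ 0)
    (h : ∀ k : ℤ, u ≠ q ^ k) : thetaProd q u ≠ 0 := by
  refine mul_ne_zero (qPochInf_ne_zero hq fun n hn ↦ h n ?_)
    (qPochInf_ne_zero hq fun n hn ↦ h (-(n + 1 : ℕ)) ?_)
  · rw [zpow_natCast]
    field_simp at hn
    exact hn.symm
  · rw [zpow_neg, zpow_natCast]
    refine eq_inv_of_mul_eq_one_left ?_
    rw [← hn]; ring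

lemma qPochInf_ne_zero_of_norm_lt_one {q a : ℂ} (hq : ‖q‖ < 1) (ha : ‖a‖ < 1) :
    qPochInf q a ≠ 0 := by
  refine qPochInf_ne_zero hq fun n hn ↦ ?_
  have : ‖a * q ^ n‖ < 1 := by
    rw [norm_mul, norm_pow]
    exact mul_lt_one_of_nonneg_of_lt_one_left (norm_nonneg _) ha (pow_le_one₀ (norm_nonneg _) hq.le)
  rw [hn] at this
  simp at this

/-! ### The theta functions in terms of the elliptic variable `u` -/

/-- `q^{1/2} = e^{πiτ}`. -/
def qHalf (τ : ℂ) : ℂ := exp (↑Real.pi * I * τ)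

lemma qHalf_sq (τ : ℂ) : qHalf τ ^ 2 = qq τ := by
  rw [qHalf, qq, ← Complex.exp_nat_mul]; congr 1; push_cast; ring

lemma qHalf_ne_zero (τ : ℂ) : qHalf τ ≠ 0 := exp_ne_zero _

lemma qq_ne_zero (τ : ℂ) : qq τ ≠ 0 := exp_ne_zero _

lemma norm_qq_lt_one (τ : UpperHalfPlane) : ‖qq τ‖ < 1 := by
  simpa [qq] using UpperHalfPlane.norm_exp_two_pi_I_lt_one τ

lemma tprod_thetaProd {q : ℂ} (hq : ‖q‖ < 1) (v : ℂ) :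
    ∏' n : ℕ, ((1 - v⁻¹ * q ^ n) * (1 - v * q ^ (n + 1)) * (1 - q ^ (n + 1)))
      = thetaProd q v * qPochInf q q := by
  have h1 : (fun n : ℕ ↦ 1 - v * q ^ (n + 1)) = fun n : ℕ ↦ 1 - v * q * q ^ n := by
    ext n; ring
  have h2 : (fun n : ℕ ↦ 1 - q ^ (n + 1)) = fun n : ℕ ↦ 1 - q * q ^ n := by
    ext n; ring
  have m1 := multipliable_qPochInf hq v⁻¹
  have m2 := h1 ▸ multipliable_qPochInf hq (v * q)
  have m3 := h2 ▸ multipliable_qPochInf hq q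
  rw [(m1.mul m2).tprod_mul m3, m1.tprod_mul m2, h1, h2]
  rfl

lemma exp_half (τ : ℂ) (n : ℕ) :
    exp (2 * ↑Real.pi * I * τ * ((n : ℂ) + 1 / 2)) = qHalf τ * qq τ ^ n := by
  rw [qHalf, qq, ← Complex.exp_nat_mul, ← Complex.exp_add]; congr 1; ring

variable (τ : UpperHalfPlane) (z : ℂ)

lemma theta1_eq : theta1 τ z = -I * exp (2 * ↑Real.pi * I * τ / 8) * exp (↑Real.pi * I * z) *
    (thetaProd (qq τ) (qq z) * qPochInf (qq τ) (qq τ)) := by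
  rw [theta1, tprod_thetaProd (norm_qq_lt_one τ)]

lemma theta2_eq : theta2 τ z = exp (2 * ↑Real.pi * I * τ / 8) * exp (↑Real.pi * I * z) *
    (thetaProd (qq τ) (-qq z) * qPochInf (qq τ) (qq τ)) := by
  rw [theta2, ← tprod_thetaProd (norm_qq_lt_one τ)]
  simp [inv_neg]

lemma theta3_eq : theta3 τ z =
    thetaProd (qq τ) (-qq z / qHalf τ) * qPochInf (qq τ) (qq τ) := by
  rw [theta3, ← tprod_thetaProd (norm_qq_lt_one τ)]
  refine tprod_congr fun n ↦ ?_
  have := qHalf_ne_zero τ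
  rw [exp_half, pow_succ' (qq τ), ← qHalf_sq (τ : ℂ)]
  field_simp
  ring

lemma theta4_eq : theta4 τ z =
    thetaProd (qq τ) (qq z / qHalf τ) * qPochInf (qq τ) (qq τ) := by
  rw [theta4, ← tprod_thetaProd (norm_qq_lt_one τ)]
  refine tprod_congr fun n ↦ ?_
  have := qHalf_ne_zero τ
  rw [exp_half, pow_succ' (qq τ), ← qHalf_sq (τ : ℂ)]
  field_simp

lemma dedekindEta_eq : dedekindEta τ = exp (2 * ↑Real.pi * I * τ / 24) *
    qPochInf (qq τ) (qq τ) := by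
  rw [dedekindEta, qPochInf]
  congr 1
  exact tprod_congr fun n ↦ by ring

/-- `Ψ_{1,1}` as a function of `u`. -/
def psiU (q u : ℂ) : ℂ := qPochInf q q ^ 2 * thetaProd q (u ^ 2) / thetaProd q u ^ 2

/-- `φ^{(3)}_1` as a function of `u`. -/
def phiU (q p u : ℂ) : ℂ :=
  2 * ((thetaProd q (-u / p) / thetaProd q (-1 / p)) ^ 2 *
      (thetaProd q (u / p) / thetaProd q (1 / p)) ^ 2 +
    (thetaProd q (u / p) / thetaProd q (1 / p)) ^ 2 *
      (u * (thetaProd q (-u) / thetaProd q (-1)) ^ 2) +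
    u * (thetaProd q (-u) / thetaProd q (-1)) ^ 2 *
      (thetaProd q (-u / p) / thetaProd q (-1 / p)) ^ 2)

lemma qPochInf_self_ne_zero : qPochInf (qq τ) (qq τ) ≠ 0 :=
  qPochInf_ne_zero_of_norm_lt_one (norm_qq_lt_one τ) (norm_qq_lt_one τ)

lemma exp_pi_sq : exp (↑Real.pi * I * z) ^ 2 = qq z := qHalf_sq z

lemma Psi11_eq : Psi11 τ z = psiU (qq τ) (qq z) := by
  have hE : exp (2 * ↑Real.pi * I * τ / 24) ^ 3 = exp (2 * ↑Real.pi * I * τ / 8) := by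
    rw [← Complex.exp_nat_mul]; congr 1; push_cast; ring
  have hz : exp (↑Real.pi * I * (2 * z)) = qq z := by rw [qq]; congr 1; ring
  have hz2 : qq (2 * z) = qq z ^ 2 := by
    rw [qq, qq, ← Complex.exp_nat_mul]; congr 1; push_cast; ring
  have h8 := exp_ne_zero (2 * ↑Real.pi * I * τ / 8)
  have hP := qPochInf_self_ne_zero τ
  have hqz := qq_ne_zero z
  rw [Psi11, theta1_eq, theta1_eq, dedekindEta_eq, mul_pow _ _ 3, hE, hz, hz2, psiU]
  simp only [mul_pow, exp_pi_sq, neg_sq, I_sq]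
  rcases eq_or_ne (thetaProd (qq τ) (qq z)) 0 with h0 | h0
  · simp [h0]
  · field_simp
    ring_nf
    simp

lemma phi31_eq : phi31 τ z = phiU (qq τ) (qHalf τ) (qq z) := by
  have h8 := exp_ne_zero (2 * ↑Real.pi * I * τ / 8)
  have hP := qPochInf_self_ne_zero τ
  have h0 : qq 0 = 1 := by simp [qq]
  rw [phi31]
  simp only [theta2_eq, theta3_eq, theta4_eq, h0, mul_pow, exp_pi_sq]
  rw [phiU]
  simp only [div_pow]
  field_simp
/-! ### Laurent expansions -/

lemma eq_zero_of_hasSum_fourier {T : ℝ} [hT : Fact (0 < T)] {b : ℤ → ℂ}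
    (h : ∀ x : AddCircle T, HasSum (fun n ↦ b n * fourier n x) 0) (m : ℤ) : b m = 0 := by
  have hb : Summable fun n ↦ ‖b n‖ := by simpa using (h 0).summable.norm
  have hn : ∀ (n : ℤ) (x : AddCircle T), ‖fourier n x‖ = 1 := fun n x ↦ Circle.norm_coe _
  have key := MeasureTheory.hasSum_integral_of_summable_integral_norm
    (μ := AddCircle.haarAddCircle (T := T))
    (F := fun n x ↦ b n * (fourier (-m) x • fourier n x))
    (fun n ↦ (Continuous.mul continuous_const
      ((fourier (-m)).continuous.smul (fourier n).continuous)).integrable_of_hasCompactSupport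
        (HasCompactSupport.of_compactSpace _)) (by simpa [-fourier_apply, norm_smul, hn] using hb)
  have h1 : ∀ n, ∫ x : AddCircle T, b n * (fourier (-m) x • fourier n x) ∂AddCircle.haarAddCircle
      = if n = m then b m else 0 := by
    intro n
    rw [MeasureTheory.integral_const_mul]
    have := congrFun (fourierCoeff_fourier (T := T) n) m
    rw [fourierCoeff] at this
    rw [this]
    by_cases hnm : n = m
    · simp [hnm]
    · simp [hnm, Ne.symm hnm]
  have h2 : ∀ x : AddCircle T, ∑' n, b n * (fourier (-m) x • fourier n x) = 0 := by
    intro x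
    have := ((h x).mul_left (fourier (-m) x)).tsum_eq
    rw [mul_zero] at this
    rw [← this]
    exact tsum_congr fun n ↦ by simp only [smul_eq_mul]; ring
  simp only [h1, h2, MeasureTheory.integral_zero] at key
  exact (hasSum_ite_eq m (b m)).unique key

/-- The coefficients of a Laurent series are determined by its values on one circle. -/
lemma eq_of_hasSum_laurent {R : ℝ} (hR : 0 < R) {a b : ℤ → ℂ} {F : ℂ → ℂ}
    (ha : ∀ u : ℂ, ‖u‖ = R → HasSum (fun n : ℤ ↦ a n * u ^ n) (F u))
    (hb : ∀ u : ℂ, ‖u‖ = R → HasSum (fun n : ℤ ↦ b n * u ^ n) (F u)) : a = b := by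
  ext m
  have hR' : (R : ℂ) ≠ 0 := by exact_mod_cast hR.ne'
  have := eq_zero_of_hasSum_fourier (T := 1) (b := fun n ↦ (a n - b n) * (R : ℂ) ^ n)
    (fun x ↦ by
      have hx : ‖(R * (AddCircle.toCircle x : Circle) : ℂ)‖ = R := by
        rw [norm_mul, Circle.norm_coe, mul_one, Complex.norm_real, Real.norm_of_nonneg hR.le]
      have := (ha _ hx).sub (hb _ hx)
      rw [sub_self] at this
      convert! this using 2 with n
      rw [fourier_apply, AddCircle.toCircle_zsmul, mul_zpow]
      push_cast
      ring) m
  simpa [sub_eq_zero, zpow_ne_zero, hR'] using this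

/-- A function holomorphic on the punctured plane is the sum of its Laurent series. -/
lemma exists_hasSum_laurent {F : ℂ → ℂ} (hF : ∀ u ≠ 0, DifferentiableAt ℂ F u) :
    ∃ c : ℤ → ℂ, ∀ u ≠ 0, HasSum (fun n : ℤ ↦ c n * u ^ n) (F u) := by
  have : Fact (0 < 2 * Real.pi) := ⟨Real.two_pi_pos⟩
  set J : ℝ → ℤ → ℂ := fun R n ↦ ∮ z in C(0, R), (z - 0)⁻¹ • (z ^ (-n) * F z) with hJ
  have hd : ∀ n : ℤ, ∀ u ≠ 0, DifferentiableAt ℂ (fun z ↦ z ^ (-n) * F z) u := fun n u hu ↦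
    (differentiableAt_zpow.mpr (Or.inl hu)).mul (hF u hu)
  have hmono : ∀ r R : ℝ, 0 < r → r ≤ R → ∀ n, J R n = J r n := by
    intro r R hr hrR n
    refine circleIntegral_sub_center_inv_smul_eq_of_differentiable_on_annulus_off_countable hr hrR
      Set.countable_empty (fun u hu ↦ ?_) fun u hu ↦ hd n u ?_
    · refine (hd n u ?_).continuousAt.continuousWithinAt
      rintro rfl
      simp at hu
      linarith
    · rintro rfl
      simp at hu
      linarith
  have hconst : ∀ R : ℝ, 0 < R → ∀ n, J R n = J 1 n := by
    intro R hR n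
    rcases le_total R 1 with h | h
    · exact (hmono R 1 hR h n).symm
    · exact hmono 1 R one_pos h n
  set c : ℤ → ℂ := fun n ↦ (2 * Real.pi * I)⁻¹ * J 1 n with hc
  have hbound : ∀ R : ℝ, 0 < R → ∃ C, ∀ n, ‖c n‖ ≤ C * R ^ (-n) := by
    intro R hR
    have hcont : ContinuousOn F (Metric.sphere 0 R) := fun u hu ↦
      (hF u (by rintro rfl; simp at hu; linarith)).continuousAt.continuousWithinAt
    obtain ⟨C, hC⟩ := (isCompact_sphere (0 : ℂ) R).exists_bound_of_continuousOn hcont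
    refine ⟨C, fun n ↦ ?_⟩
    rw [hc]
    simp only
    rw [← hconst R hR n]
    have := circleIntegral.norm_two_pi_i_inv_smul_integral_le_of_norm_le_const (c := 0) (R := R)
      (f := fun z ↦ (z - 0)⁻¹ • (z ^ (-n) * F z)) (C := R⁻¹ * (R ^ (-n) * C)) hR.le (by
        intro z hz
        have hz' : ‖z‖ = R := by simpa using hz
        rw [norm_smul, norm_mul, norm_zpow, sub_zero, norm_inv, hz']
        gcongr
        exact hC z hz)
    rw [smul_eq_mul] at this
    refine this.trans (le_of_eq ?_)
    field_simp
  refine ⟨c, fun u hu ↦ ?_⟩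
  set R := ‖u‖ with hRdef
  have hR : 0 < R := norm_pos_iff.mpr hu
  have hR0 : (R : ℂ) ≠ 0 := by exact_mod_cast hR.ne'
  have hne : ∀ x : AddCircle (2 * Real.pi), (R * (AddCircle.toCircle x : Circle) : ℂ) ≠ 0 :=
    fun x ↦ mul_ne_zero hR0 (Circle.coe_ne_zero _)
  let f : C(AddCircle (2 * Real.pi), ℂ) := ⟨fun x ↦ F (R * (AddCircle.toCircle x : Circle)), by
    refine continuous_iff_continuousAt.mpr fun x ↦ ?_
    refine ContinuousAt.comp (f := fun x ↦ (R * (AddCircle.toCircle x : Circle) : ℂ))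
      (hF _ (hne x)).continuousAt ?_
    have := AddCircle.continuous_toCircle (T := 2 * Real.pi)
    fun_prop⟩
  have hcoef : ∀ n, fourierCoeff f n = c n * R ^ n := by
    intro n
    rw [fourierCoeff_eq_intervalIntegral f n 0, hc]
    simp only
    rw [← hconst R hR n, hJ]
    simp only [circleIntegral, zero_add]
    rw [Complex.real_smul, mul_assoc, ← intervalIntegral.integral_mul_const,
      ← intervalIntegral.integral_const_mul, ← intervalIntegral.integral_const_mul]
    refine intervalIntegral.integral_congr fun t _ ↦ ?_
    have ht : circleMap 0 R t = R * (AddCircle.toCircle (t : AddCircle (2 * Real.pi)) : Circle) := by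
      rw [AddCircle.toCircle_apply_mk, circleMap_zero, Circle.coe_exp]
      congr 3
      push_cast
      field_simp
    have hm : circleMap 0 R t ≠ 0 := ht ▸ hne _
    simp only [f, ContinuousMap.coe_mk, fourier_apply, AddCircle.toCircle_zsmul, ← ht,
      deriv_circleMap, smul_eq_mul, sub_zero, Circle.coe_zpow]
    have ht' : ((AddCircle.toCircle (t : AddCircle (2 * Real.pi)) : Circle) : ℂ)
        = circleMap 0 R t / R := by rw [ht]; field_simp
    rw [ht', div_zpow, zpow_neg (R : ℂ) n]
    have := I_ne_zero
    push_cast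
    field_simp
  have hsum : Summable fun n : ℤ ↦ c n * (R : ℂ) ^ n := by
    obtain ⟨C₁, h₁⟩ := hbound (2 * R) (by positivity)
    obtain ⟨C₂, h₂⟩ := hbound (R / 2) (by positivity)
    refine Summable.of_nat_of_neg ?_ ?_
    · refine Summable.of_norm_bounded
        ((summable_geometric_of_lt_one (by norm_num) one_half_lt_one).mul_left C₁) fun n ↦ ?_
      rw [norm_mul, norm_zpow, Complex.norm_real, Real.norm_of_nonneg hR.le]
      refine (mul_le_mul_of_nonneg_right (h₁ n) (by positivity)).trans (le_of_eq ?_)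
      simp only [zpow_neg, zpow_natCast, mul_pow, one_div, inv_pow]
      field_simp
    · refine Summable.of_norm_bounded
        ((summable_geometric_of_lt_one (by norm_num) one_half_lt_one).mul_left C₂) fun n ↦ ?_
      rw [norm_mul, norm_zpow, Complex.norm_real, Real.norm_of_nonneg hR.le]
      refine (mul_le_mul_of_nonneg_right (h₂ (-n)) (by positivity)).trans (le_of_eq ?_)
      simp only [zpow_neg, zpow_natCast, div_pow, one_div, inv_pow, neg_neg]
      field_simp
  obtain ⟨x, hx⟩ : ∃ x : AddCircle (2 * Real.pi), (R * (AddCircle.toCircle x : Circle) : ℂ) = u := by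
    refine ⟨(u.arg : ℝ), ?_⟩
    rw [AddCircle.toCircle_apply_mk, Circle.coe_exp]
    conv_rhs => rw [← Complex.norm_mul_exp_arg_mul_I u]
    congr 3
    push_cast
    field_simp
  have hfs := has_pointwise_sum_fourier_series_of_summable (f := f)
    (by simpa only [funext hcoef] using hsum) x
  have hfx : f x = F u := by simp [f, hx]
  rw [hfx] at hfs
  convert! hfs using 2 with n
  rw [hcoef, fourier_apply, AddCircle.toCircle_zsmul, ← hx, mul_zpow, smul_eq_mul]
  push_cast
  ring
/-! ### The Appell–Lerch sum -/

lemma summable_gauss {c : ℝ} (hc : 0 < c) {a : ℂ} (ha : a ≠ 0) :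
    Summable fun k : ℤ ↦ a ^ k * exp (2 * ↑Real.pi * I * τ * (c * (k : ℂ) ^ 2)) := by
  have h := (summable_jacobiTheta₂_term_iff (log a / (2 * Real.pi * I)) (2 * c * τ)).mpr (by
    have := τ.im_pos
    have h2 : (2 * c * τ : ℂ).im = 2 * c * τ.im := by
      rw [show (2 * c * τ : ℂ) = ((2 * c : ℝ) : ℂ) * τ by push_cast; ring,
        Complex.im_ofReal_mul]
      rfl
    rw [h2]
    positivity)
  refine h.congr fun k ↦ ?_
  rw [jacobiTheta₂_term, Complex.exp_add]
  congr 1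
  · have : (2 * Real.pi * I : ℂ) ≠ 0 := two_pi_I_ne_zero
    conv_rhs => rw [← Complex.exp_log ha, ← Complex.exp_int_mul]
    congr 1
    field_simp
  · congr 1; ring

/-- The summand of `μ_{3,0}` as a function of `u`. -/
def muTerm (q : ℂ) (k : ℤ) (u : ℂ) : ℂ :=
  u ^ (6 * k) * q ^ (3 * k ^ 2) * ((u * q ^ k + 1) / (u * q ^ k - 1))

/-- `μ_{3,0}` as a function of `u`. -/
def muU (q u : ℂ) : ℂ := ∑' k : ℤ, muTerm q k u

lemma mu_eq : mu 3 τ z = muU (qq τ) (qq z) := by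
  refine tsum_congr fun k ↦ ?_
  rw [muTerm, show 2 * k * ((3 : ℕ) : ℤ) = 6 * k by push_cast; ring]
  rfl

lemma muTerm_mul_left {q u : ℂ} (hq : q ≠ 0) (hu : u ≠ 0) (k : ℤ) :
    muTerm q k (q * u) = q⁻¹ ^ 3 * u⁻¹ ^ 6 * muTerm q (k + 1) u := by
  rw [muTerm, muTerm, show q * u * q ^ k = u * q ^ (k + 1) by rw [zpow_add_one₀ hq]; ring,
    ← mul_assoc]
  congr 1
  rw [mul_zpow, show 6 * (k + 1) = 6 * k + (6 : ℕ) by push_cast; ring,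
    show 3 * (k + 1) ^ 2 = 3 * k ^ 2 + 6 * k + (3 : ℕ) by push_cast; ring, zpow_add₀ hu,
    zpow_add₀ hq, zpow_add₀ hq, zpow_natCast, zpow_natCast]
  field_simp

lemma muU_mul_left {q u : ℂ} (hq : q ≠ 0) (hu : u ≠ 0) :
    muU q (q * u) = q⁻¹ ^ 3 * u⁻¹ ^ 6 * muU q u := by
  simp only [muU, muTerm_mul_left hq hu, tsum_mul_left]
  congr 1
  exact (Equiv.addRight (1 : ℤ)).tsum_eq (muTerm q · u)

lemma norm_add_one_div_sub_one_le {v : ℂ} (hv : ‖v‖ ≤ 1 / 2 ∨ 2 ≤ ‖v‖) :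
    ‖(v + 1) / (v - 1)‖ ≤ 3 := by
  have h1 : ‖v + 1‖ ≤ ‖v‖ + 1 := by simpa using norm_add_le v 1
  have h2 : ‖v‖ - 1 ≤ ‖v - 1‖ := by simpa using norm_sub_norm_le v 1
  have h3 : 1 - ‖v‖ ≤ ‖v - 1‖ := by simpa [norm_sub_rev] using norm_sub_norm_le 1 v
  rw [norm_div]
  refine div_le_of_le_mul₀ (norm_nonneg _) (by norm_num) ?_
  rcases hv with hv | hv <;> linarith

lemma analyticAt_muTerm {q u : ℂ} (hu : u ≠ 0) {k : ℤ} (hk : u * q ^ k ≠ 1) :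
    AnalyticAt ℂ (muTerm q k) u := by
  unfold muTerm
  refine ((analyticAt_id.fun_zpow hu).mul analyticAt_const).mul
    (.div ?_ ?_ (sub_ne_zero.mpr hk))
  all_goals fun_prop

/-- Near any point of the punctured plane, `μ_{3,0}` is a finite sum of its terms up to a
holomorphic function. -/
lemma exists_muU_eq_sum_add {u₀ : ℂ} (hu₀ : u₀ ≠ 0) :
    ∃ (S : Finset ℤ) (D : ℂ → ℂ), 0 ∈ S ∧ AnalyticAt ℂ D u₀ ∧
      ∀ᶠ u in 𝓝 u₀, muU (qq τ) u = ∑ k ∈ S, muTerm (qq τ) k u + D u := by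
  set q := qq τ with hqdef
  have hq : ‖q‖ < 1 := norm_qq_lt_one τ
  have hq0 : 0 < ‖q‖ := norm_pos_iff.mpr (qq_ne_zero τ)
  set r := ‖u₀‖ / 2 with hr
  set R := 2 * ‖u₀‖ with hR
  have hn0 : 0 < ‖u₀‖ := norm_pos_iff.mpr hu₀
  have hr0 : 0 < r := by positivity
  have hR0 : 0 < R := by positivity
  obtain ⟨N, hN⟩ : ∃ N : ℕ, ‖q‖ ^ N < min (1 / (2 * R)) (r / 2) :=
    exists_pow_lt_of_lt_one (by positivity) hq
  have hN1 : ‖q‖ ^ N * R ≤ 1 / 2 := by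
    have := (hN.trans_le (min_le_left _ _)).le
    calc ‖q‖ ^ N * R ≤ 1 / (2 * R) * R := by gcongr
      _ = 1 / 2 := by field_simp
  have hN2 : 2 ≤ r * (‖q‖ ^ N)⁻¹ := by
    have := (hN.trans_le (min_le_right _ _)).le
    rw [← div_eq_mul_inv, le_div_iff₀ (by positivity)]
    linarith
  set U : Set ℂ := {u | r < ‖u‖ ∧ ‖u‖ < R} with hU
  have hUo : IsOpen U := (isOpen_lt continuous_const continuous_norm).inter
    (isOpen_lt continuous_norm continuous_const)
  have hu₀U : u₀ ∈ U := by constructor <;> simp only [hr, hR] <;> linarith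
  have hU0 : ∀ u ∈ U, u ≠ 0 := by
    rintro u hu rfl
    have := hu.1
    rw [norm_zero] at this
    linarith
  set S : Finset ℤ := Finset.Icc (-N : ℤ) N with hS
  have hfar : ∀ k ∉ S, ∀ u ∈ U, ‖u * q ^ k‖ ≤ 1 / 2 ∨ 2 ≤ ‖u * q ^ k‖ := by
    intro k hk u hu
    rw [norm_mul, norm_zpow]
    rw [hS, Finset.mem_Icc, not_and_or, not_le, not_le] at hk
    rcases hk with hk | hk
    · right
      refine hN2.trans ?_
      rw [← zpow_natCast, ← zpow_neg]
      have := zpow_le_zpow_right_of_le_one₀ hq0 hq.le hk.le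
      gcongr
      exact hu.1.le
    · left
      refine le_trans ?_ hN1
      rw [mul_comm, ← zpow_natCast]
      have := zpow_le_zpow_right_of_le_one₀ hq0 hq.le hk.le
      gcongr
      exact hu.2.le
  set b : ℤ → ℝ := fun k ↦ ((R ^ 6) ^ k + (r ^ 6) ^ k) * ‖q‖ ^ (3 * k ^ 2) * 3 with hb
  have hgauss : ∀ x : ℝ, 0 < x → Summable fun k : ℤ ↦ x ^ k * ‖q‖ ^ (3 * k ^ 2) := by
    intro x hx
    have := (summable_gauss τ (c := 3) (by norm_num) (a := x) (by exact_mod_cast hx.ne')).norm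
    refine this.congr fun k ↦ ?_
    rw [norm_mul, norm_zpow, Complex.norm_real, Real.norm_of_nonneg hx.le, ← norm_zpow, hqdef, qq,
      ← Complex.exp_int_mul]
    congr 3
    push_cast
    ring
  have hbs : Summable b := by
    have := ((hgauss (R ^ 6) (by positivity)).add (hgauss (r ^ 6) (by positivity))).mul_right 3
    exact this.congr fun k ↦ by simp only [hb]; ring
  have hle : ∀ k ∉ S, ∀ u ∈ U, ‖muTerm q k u‖ ≤ b k := by
    intro k hk u hu
    have hu0 : 0 < ‖u‖ := norm_pos_iff.mpr (hU0 u hu)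
    rw [muTerm, norm_mul, norm_mul, norm_zpow, norm_zpow]
    have h3 := norm_add_one_div_sub_one_le (hfar k hk u hu)
    have h6 : ‖u‖ ^ (6 * k) ≤ (R ^ 6) ^ k + (r ^ 6) ^ k := by
      rw [zpow_mul]
      norm_cast
      have hR6 : 0 ≤ (R ^ 6) ^ k := by positivity
      have hr6 : 0 ≤ (r ^ 6) ^ k := by positivity
      rcases le_total 0 k with h0 | h0
      · have : (‖u‖ ^ 6) ^ k ≤ (R ^ 6) ^ k := by
          have := hu.2.le
          exact zpow_le_zpow_left₀ h0 (by positivity) (by gcongr)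
        linarith
      · have : (‖u‖ ^ 6) ^ k ≤ (r ^ 6) ^ k := by
          obtain ⟨n, rfl⟩ := Int.exists_eq_neg_ofNat h0
          have := hu.1.le
          simp only [zpow_neg, zpow_natCast]
          gcongr
        linarith
    simp only [hb]
    gcongr
  refine ⟨S, fun u ↦ ∑' k : {k // k ∉ S}, muTerm q k u, by simp [hS], ?_, ?_⟩
  · refine DifferentiableOn.analyticAt (s := U) ?_ (hUo.mem_nhds hu₀U)
    refine differentiableOn_tsum_of_summable_norm (u := fun k : {k // k ∉ S} ↦ b k)
      (hbs.subtype _) (fun k u hu ↦ ?_) hUo fun k u hu ↦ hle k k.2 u hu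
    refine (analyticAt_muTerm (hU0 u hu) fun h ↦ ?_).differentiableWithinAt
    have := hfar k k.2 u hu
    rw [h] at this
    norm_num at this
  · filter_upwards [hUo.mem_nhds hu₀U] with u hu
    have hs : Summable fun k : {k // k ∉ S} ↦ muTerm q k u :=
      Summable.of_norm_bounded (g := fun k : {k // k ∉ S} ↦ b k) (hbs.subtype _)
        fun k ↦ hle k k.2 u hu
    exact ((S.summable_compl_iff (f := fun k ↦ muTerm q k u)).mp hs).sum_add_tsum_subtype_compl S
      |>.symm
/-! ### Holomorphic extension across the lattice -/

/-- The meromorphic Jacobi form `-2 Ψ_{1,1} φ^{(3)}_1` plus `12 μ_{3,0}`, as a function of `u`. -/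
def finiteU (q p u : ℂ) : ℂ := -2 * psiU q u * phiU q p u + 12 * muU q u

lemma analyticAt_of_differentiableAt_ne_zero {f : ℂ → ℂ} (h : ∀ u ≠ 0, DifferentiableAt ℂ f u)
    {u : ℂ} (hu : u ≠ 0) : AnalyticAt ℂ f u :=
  DifferentiableOn.analyticAt (s := {0}ᶜ) (fun w hw ↦ (h w hw).differentiableWithinAt)
    (isOpen_compl_singleton.mem_nhds hu)

lemma psiU_mul_left {q u : ℂ} (hq0 : q ≠ 0) (hq : ‖q‖ < 1) (hu : u ≠ 0) :
    psiU q (q * u) = q⁻¹ * u⁻¹ ^ 2 * psiU q u := by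
  rw [psiU, psiU, show (q * u) ^ 2 = q * (q * u ^ 2) by ring,
    thetaProd_mul_left hq0 hq (by positivity), thetaProd_mul_left hq0 hq (by positivity),
    thetaProd_mul_left hq0 hq hu]
  field_simp

lemma phiU_mul_left {q p u : ℂ} (hp : p ^ 2 = q) (hq0 : q ≠ 0) (hq : ‖q‖ < 1) (hu : u ≠ 0) :
    phiU q p (q * u) = q⁻¹ ^ 2 * u⁻¹ ^ 4 * phiU q p u := by
  have hp0 : p ≠ 0 := by rintro rfl; exact hq0 (by rw [← hp]; ring)
  rw [phiU, phiU, show -(q * u) / p = q * (-u / p) by ring, show q * u / p = q * (u / p) by ring,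
    show -(q * u) = q * -u by ring, thetaProd_mul_left hq0 hq (div_ne_zero (neg_ne_zero.mpr hu) hp0),
    thetaProd_mul_left hq0 hq (div_ne_zero hu hp0), thetaProd_mul_left hq0 hq (neg_ne_zero.mpr hu)]
  simp only [div_pow, mul_pow, neg_sq, inv_pow, ← hp]
  field_simp

lemma finiteU_mul_left {q p u : ℂ} (hp : p ^ 2 = q) (hq0 : q ≠ 0) (hq : ‖q‖ < 1) (hu : u ≠ 0) :
    finiteU q p (q * u) = q⁻¹ ^ 3 * u⁻¹ ^ 6 * finiteU q p u := by
  rw [finiteU, finiteU, psiU_mul_left hq0 hq hu, phiU_mul_left hp hq0 hq hu, muU_mul_left hq0 hu]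
  ring

lemma differentiableAt_phiU {q p u : ℂ} (hp0 : p ≠ 0) (hq : ‖q‖ < 1) (hu : u ≠ 0) :
    DifferentiableAt ℂ (phiU q p) u := by
  have h1 : DifferentiableAt ℂ (fun u ↦ thetaProd q (-u / p)) u :=
    (differentiableAt_thetaProd hq (div_ne_zero (neg_ne_zero.mpr hu) hp0)).comp
      (f := fun u ↦ -u / p) u (by fun_prop)
  have h2 : DifferentiableAt ℂ (fun u ↦ thetaProd q (u / p)) u :=
    (differentiableAt_thetaProd hq (div_ne_zero hu hp0)).comp (f := fun u ↦ u / p) u (by fun_prop)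
  have h3 : DifferentiableAt ℂ (fun u ↦ thetaProd q (-u)) u :=
    (differentiableAt_thetaProd hq (neg_ne_zero.mpr hu)).comp (f := fun u ↦ -u) u (by fun_prop)
  unfold phiU
  fun_prop

/-- If `f` has a removable singularity at each point of the punctured plane, the function
`u ↦ lim_{w → u} f w` is holomorphic there. -/
lemma differentiableAt_limUnder {f g : ℂ → ℂ} {u : ℂ} (hg : AnalyticAt ℂ g u)
    (hfg : f =ᶠ[𝓝[≠] u] g) :
    DifferentiableAt ℂ (fun w ↦ limUnder (𝓝[≠] w) f) u := by
  refine hg.differentiableAt.congr_of_eventuallyEq ?_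
  have h1 : ∀ᶠ w in 𝓝[≠] u, f =ᶠ[𝓝 w] g := by
    obtain ⟨t, ht, hto, hut⟩ := eventually_nhds_iff.mp (eventually_nhdsWithin_iff.mp hfg)
    filter_upwards [mem_nhdsWithin_of_mem_nhds (hto.mem_nhds hut), self_mem_nhdsWithin]
      with w hw hwu
    filter_upwards [hto.mem_nhds hw, isOpen_compl_singleton.mem_nhds hwu] with v hv hvu
      using ht v hv hvu
  have h2 : ∀ᶠ w in 𝓝 u, f =ᶠ[𝓝[≠] w] g := by
    have := eventually_nhdsWithin_iff.mp h1
    filter_upwards [this] with w hw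
    by_cases hwu : w = u
    · rwa [hwu]
    · exact (hw hwu).filter_mono nhdsWithin_le_nhds
  filter_upwards [h2, hg.eventually_analyticAt] with w hw hga
  exact (((hga.continuousAt.tendsto.mono_left nhdsWithin_le_nhds).congr' hw.symm)).limUnder_eq

lemma zpow_qq_ne_one {k : ℤ} (hk : k ≠ 0) : qq τ ^ k ≠ 1 := by
  intro h
  have h1 : ‖qq τ‖ ^ k = 1 := by rw [← norm_zpow, h, norm_one]
  rw [zpow_eq_one_iff_right₀ (norm_nonneg _) (norm_qq_lt_one τ).ne] at h1
  exact hk h1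

lemma analyticAt_finiteU {u : ℂ} (hu : u ≠ 0) (h : ∀ k : ℤ, u ≠ qq τ ^ k) :
    AnalyticAt ℂ (finiteU (qq τ) (qHalf τ)) u := by
  have hq := norm_qq_lt_one τ
  have hT : AnalyticAt ℂ (thetaProd (qq τ)) u :=
    analyticAt_of_differentiableAt_ne_zero (fun w hw ↦ differentiableAt_thetaProd hq hw) hu
  have hT2 : AnalyticAt ℂ (fun u ↦ thetaProd (qq τ) (u ^ 2)) u :=
    analyticAt_of_differentiableAt_ne_zero (fun w hw ↦
      (differentiableAt_thetaProd hq (pow_ne_zero 2 hw)).comp (f := fun u ↦ u ^ 2) w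
        (by fun_prop)) hu
  have hpsi : AnalyticAt ℂ (psiU (qq τ)) u :=
    (analyticAt_const.mul hT2).div (hT.pow 2)
      (pow_ne_zero 2 (thetaProd_ne_zero hq hu h))
  have hphi : AnalyticAt ℂ (phiU (qq τ) (qHalf τ)) u :=
    analyticAt_of_differentiableAt_ne_zero
      (fun w hw ↦ differentiableAt_phiU (qHalf_ne_zero τ) hq hw) hu
  have hmu : AnalyticAt ℂ (muU (qq τ)) u := by
    obtain ⟨S, D, -, hD, hS⟩ := exists_muU_eq_sum_add τ hu
    refine AnalyticAt.congr (f := fun u ↦ ∑ k ∈ S, muTerm (qq τ) k u + D u)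
      (AnalyticAt.add (Finset.analyticAt_fun_sum _ fun k _ ↦ ?_) hD) (hS.mono fun w hw ↦ hw.symm)
    refine analyticAt_muTerm hu fun hk ↦ h (-k) ?_
    rw [zpow_neg]
    exact eq_inv_of_mul_eq_one_left hk
  exact ((analyticAt_const.mul hpsi).mul hphi).add (analyticAt_const.mul hmu)

lemma psiU_eq_mul {q u : ℂ} (hq : ‖q‖ < 1) (hu : u ≠ 0) (hu1 : u ≠ 1) :
    psiU q u = (u + 1) / (u - 1) * (qPochInf q q ^ 2 *
      (qPochInf q ((u ^ 2)⁻¹ * q) * qPochInf q (u ^ 2 * q)) /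
      (qPochInf q (u⁻¹ * q) * qPochInf q (u * q)) ^ 2) := by
  have h1 : u - 1 ≠ 0 := sub_ne_zero.mpr hu1
  have h2 : (1 - (u ^ 2)⁻¹) = (u + 1) * (u - 1) / u ^ 2 := by field_simp; ring
  have h3 : 1 - u⁻¹ = (u - 1) / u := by field_simp
  rw [psiU, thetaProd_eq_mul hq, thetaProd_eq_mul hq, h2, h3, mul_pow _ (_ * _) 2]
  field_simp

lemma phiU_one : phiU (qq τ) (qHalf τ) 1 = 6 := by
  have hq := norm_qq_lt_one τ
  have hp : ‖qHalf τ‖ ^ 2 = ‖qq τ‖ := by rw [← norm_pow, qHalf_sq]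
  have hp0 : 0 < ‖qHalf τ‖ := norm_pos_iff.mpr (qHalf_ne_zero τ)
  have hpow : ∀ k : ℤ, (qHalf τ)⁻¹ ≠ -qq τ ^ k ∧ (qHalf τ)⁻¹ ≠ qq τ ^ k := by
    intro k
    suffices ‖(qHalf τ)⁻¹‖ ≠ ‖qq τ ^ k‖ from
      ⟨fun h ↦ this (by rw [h, norm_neg]), fun h ↦ this (by rw [h])⟩
    intro h
    rw [norm_inv, norm_zpow, ← hp, ← zpow_natCast, ← zpow_mul, inv_eq_iff_eq_inv, ← zpow_neg] at h
    have hlt : ‖qHalf τ‖ ≠ 1 := fun h ↦ by rw [← hp, h] at hq; norm_num at hq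
    have := zpow_right_injective₀ hp0 hlt ((zpow_one _).trans h)
    push_cast at this
    omega
  have h1 : thetaProd (qq τ) (-1 / qHalf τ) ≠ 0 :=
    thetaProd_ne_zero hq (div_ne_zero (by norm_num) (qHalf_ne_zero τ)) fun k hk ↦
      (hpow k).1 (by rw [← hk]; ring)
  have h2 : thetaProd (qq τ) (1 / qHalf τ) ≠ 0 :=
    thetaProd_ne_zero hq (div_ne_zero (by norm_num) (qHalf_ne_zero τ)) fun k hk ↦
      (hpow k).2 (by rw [← hk]; ring)
  have h3 : thetaProd (qq τ) (-1) ≠ 0 := by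
    refine thetaProd_ne_zero hq (by norm_num) fun k hk ↦ ?_
    rcases eq_or_ne k 0 with rfl | hk0
    · norm_num at hk
    · refine zpow_qq_ne_one τ (k := 2 * k) (by omega) ?_
      rw [mul_comm, zpow_mul, ← hk]
      norm_num
  rw [phiU, div_self h1, div_self h2, div_self h3]
  norm_num

/-- The pole of `-2 Ψ_{1,1} φ^{(3)}_1` at the origin cancels against that of `12 μ_{3,0}`. -/
lemma exists_analyticAt_one :
    ∃ g : ℂ → ℂ, AnalyticAt ℂ g 1 ∧ finiteU (qq τ) (qHalf τ) =ᶠ[𝓝[≠] 1] g := by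
  have hq := norm_qq_lt_one τ
  set q := qq τ with hqdef
  obtain ⟨S, D, h0S, hD, hS⟩ := exists_muU_eq_sum_add τ one_ne_zero
  have hP : qPochInf q q ≠ 0 := qPochInf_self_ne_zero τ
  set W : ℂ → ℂ := fun u ↦ qPochInf q q ^ 2 *
      (qPochInf q ((u ^ 2)⁻¹ * q) * qPochInf q (u ^ 2 * q)) /
      (qPochInf q (u⁻¹ * q) * qPochInf q (u * q)) ^ 2 with hW
  have hPa : ∀ f : ℂ → ℂ, (∀ u ≠ 0, DifferentiableAt ℂ f u) →
      AnalyticAt ℂ (fun u ↦ qPochInf q (f u)) 1 := fun f hf ↦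
    analyticAt_of_differentiableAt_ne_zero
      (fun u hu ↦ (differentiable_qPochInf hq _).comp u (hf u hu)) one_ne_zero
  have hWa : AnalyticAt ℂ W 1 := by
    refine .div (analyticAt_const.mul ((hPa _ fun u hu ↦ ?_).mul (hPa _ fun u hu ↦ ?_)))
      (((hPa _ fun u hu ↦ ?_).mul (hPa _ fun u hu ↦ ?_)).pow 2) (by simpa using hP)
    · exact ((differentiableAt_fun_id.pow 2).inv (pow_ne_zero 2 hu)).mul_const _
    · fun_prop
    · exact (differentiableAt_inv hu).mul_const _
    · fun_prop
  have hW1 : W 1 = 1 := by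
    simp only [hW, one_pow, inv_one, one_mul]
    field_simp
  have hphi : AnalyticAt ℂ (phiU q (qHalf τ)) 1 :=
    analyticAt_of_differentiableAt_ne_zero
      (fun w hw ↦ differentiableAt_phiU (qHalf_ne_zero τ) hq hw) one_ne_zero
  set B : ℂ → ℂ := fun u ↦ -2 * W u * phiU q (qHalf τ) u + 12 with hB
  have hBa : AnalyticAt ℂ B 1 :=
    ((analyticAt_const.mul hWa).mul hphi).add analyticAt_const
  have hB1 : B 1 = 0 := by
    simp only [hB, hW1, hqdef, phiU_one]
    norm_num
  have hdB : AnalyticAt ℂ (dslope B 1) 1 := by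
    obtain ⟨p, hp⟩ := hBa
    exact hp.has_fpower_series_dslope_fslope.analyticAt
  refine ⟨fun u ↦ (u + 1) * dslope B 1 u + 12 * (∑ k ∈ S.erase 0, muTerm q k u + D u), ?_, ?_⟩
  · refine .add (.mul (by fun_prop) hdB) (analyticAt_const.mul
      (AnalyticAt.add (Finset.analyticAt_fun_sum _ fun k hk ↦ ?_) hD))
    refine analyticAt_muTerm one_ne_zero ?_
    rw [one_mul]
    exact zpow_qq_ne_one τ (Finset.ne_of_mem_erase hk)
  · filter_upwards [self_mem_nhdsWithin, mem_nhdsWithin_of_mem_nhds hS,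
      mem_nhdsWithin_of_mem_nhds (isOpen_compl_singleton.mem_nhds (one_ne_zero (α := ℂ)))]
      with u hu1 hSu hu0
    have hu1' : u - 1 ≠ 0 := sub_ne_zero.mpr hu1
    rw [finiteU, hSu, ← Finset.add_sum_erase S _ h0S, psiU_eq_mul hq hu0 hu1, dslope_of_ne _ hu1,
      slope_def_field, hB1, sub_zero]
    simp only [muTerm, hB, hW]
    simp only [mul_zero, zpow_zero, mul_one, one_mul, ne_eq, OfNat.ofNat_ne_zero, not_false_eq_true,
      zero_pow]
    field_simp
    ring

lemma exists_analyticAt_finiteU {u : ℂ} (hu : u ≠ 0) :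
    ∃ g : ℂ → ℂ, AnalyticAt ℂ g u ∧ finiteU (qq τ) (qHalf τ) =ᶠ[𝓝[≠] u] g := by
  have hq0 := qq_ne_zero τ
  have hq := norm_qq_lt_one τ
  by_cases h : ∀ k : ℤ, u ≠ qq τ ^ k
  · exact ⟨_, analyticAt_finiteU τ hu h, .rfl⟩
  push Not at h
  obtain ⟨k, rfl⟩ := h
  have htend : ∀ {c : ℂ} (v : ℂ), c ≠ 0 → Tendsto (fun w ↦ c * w) (𝓝[≠] v) (𝓝[≠] (c * v)) :=
    fun {c} v hc ↦ tendsto_nhdsWithin_of_tendsto_nhds_of_eventually_within _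
      (((continuous_const_mul c).tendsto v).mono_left nhdsWithin_le_nhds) (by
        filter_upwards [self_mem_nhdsWithin] with w hw h using hw (mul_left_cancel₀ hc h))
  have hne : ∀ k : ℤ, ∀ᶠ w in 𝓝[≠] (qq τ ^ k), w ≠ 0 := fun k ↦
    mem_nhdsWithin_of_mem_nhds (isOpen_compl_singleton.mem_nhds (zpow_ne_zero k hq0))
  clear hu
  induction k using Int.induction_on with
  | zero => simpa using exists_analyticAt_one τ
  | succ k ih =>
    obtain ⟨g, hg, hfg⟩ := ih
    have hk : (qq τ)⁻¹ * qq τ ^ ((k : ℤ) + 1) = qq τ ^ (k : ℤ) := by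
      rw [zpow_add_one₀ hq0]; field_simp
    rw [← hk] at hg hfg
    refine ⟨fun w ↦ (qq τ)⁻¹ ^ 3 * ((qq τ)⁻¹ * w)⁻¹ ^ 6 * g ((qq τ)⁻¹ * w), ?_, ?_⟩
    · refine .mul (.mul analyticAt_const (.pow (.inv (by fun_prop) ?_) 6))
        (hg.comp (f := fun w ↦ (qq τ)⁻¹ * w) (by fun_prop))
      exact mul_ne_zero (inv_ne_zero hq0) (zpow_ne_zero _ hq0)
    · filter_upwards [(htend _ (inv_ne_zero hq0)).eventually hfg, hne _] with w hw hw0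
      rw [← hw, ← finiteU_mul_left (qHalf_sq _) hq0 hq (mul_ne_zero (inv_ne_zero hq0) hw0),
        mul_inv_cancel_left₀ hq0]
  | pred k ih =>
    obtain ⟨g, hg, hfg⟩ := ih
    have hk : qq τ * qq τ ^ (-(k : ℤ) - 1) = qq τ ^ (-(k : ℤ)) := by
      rw [zpow_sub_one₀ hq0]; field_simp
    rw [← hk] at hg hfg
    refine ⟨fun w ↦ qq τ ^ 3 * w ^ 6 * g (qq τ * w), ?_, ?_⟩
    · exact .mul (by fun_prop) (hg.comp (f := fun w ↦ qq τ * w) (by fun_prop))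
    · filter_upwards [(htend _ hq0).eventually hfg, hne _] with w hw hw0
      rw [← hw, finiteU_mul_left (qHalf_sq _) hq0 hq hw0]
      field_simp

/-! ### Theta decomposition -/

/-- The factor `q^{n²/12}`. -/
def qTwelfth (τ : ℂ) (n : ℤ) : ℂ := exp (2 * ↑Real.pi * I * τ * ((n : ℂ) ^ 2 / 12))

lemma qTwelfth_ne_zero (τ : ℂ) (n : ℤ) : qTwelfth τ n ≠ 0 := exp_ne_zero _

lemma qTwelfth_add_six (τ : ℂ) (n : ℤ) :
    qTwelfth τ (n + 6) = qTwelfth τ n * qq τ ^ (n + 3) := by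
  rw [qTwelfth, qTwelfth, qq, ← exp_int_mul, ← exp_add]
  congr 1
  push_cast
  ring

lemma tsum_eq_sum_zmod_six {F : ℤ → ℂ} (hF : Summable F) :
    ∑' n, F n = ∑ r : ZMod 6, ∑' k : ℤ, F (6 * k + r.val) := by
  let e : Fin 6 × ℤ ≃ ℤ := (Equiv.prodComm _ _).trans (Int.divModEquiv 6).symm
  have he : ∀ (r : Fin 6) (k : ℤ), e (r, k) = 6 * k + (r.val : ℤ) := fun r k ↦ by
    rw [mul_comm]
    rfl
  have hes : Summable fun p ↦ F (e p) := e.summable_iff.mpr hF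
  rw [← e.tsum_eq, hes.tsum_prod, tsum_fintype]
  simp only [he]
  rfl

lemma hasSum_thetam (h : ZMod 6 → ℂ) :
    HasSum (fun n : ℤ ↦ h n * qTwelfth τ n * qq z ^ n)
      (∑ r : ZMod 6, h r * thetam 3 (r.val : ℤ) τ z) := by
  obtain ⟨C, hC⟩ : ∃ C, ∀ r, ‖h r‖ ≤ C :=
    ⟨∑ r, ‖h r‖, fun r ↦ Finset.single_le_sum (fun _ _ ↦ norm_nonneg _) (Finset.mem_univ r)⟩
  have hs : Summable fun n : ℤ ↦ h n * qTwelfth τ n * qq z ^ n := by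
    refine .of_norm_bounded
      ((summable_gauss τ (c := 1 / 12) (by norm_num) (qq_ne_zero z)).norm.mul_left C) fun n ↦ ?_
    rw [mul_assoc, norm_mul, mul_comm (qTwelfth _ _), qTwelfth]
    refine mul_le_mul (hC _) (le_of_eq ?_) (norm_nonneg _) ((norm_nonneg _).trans (hC 0))
    push_cast
    ring_nf
  have key : ∑' n : ℤ, h n * qTwelfth τ n * qq z ^ n
      = ∑ r : ZMod 6, h r * thetam 3 (r.val : ℤ) τ z := by
    rw [tsum_eq_sum_zmod_six hs]
    refine Finset.sum_congr rfl fun r _ ↦ ?_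
    rw [thetam, ← tsum_mul_left]
    refine tsum_congr fun k ↦ ?_
    have hr : ((6 * k + r.val : ℤ) : ZMod 6) = r := by
      have h6 : (6 : ZMod 6) = 0 := rfl
      push_cast
      rw [ZMod.natCast_zmod_val, h6, zero_mul, zero_add]
    have h23 : 2 * ((3 : ℕ) : ℤ) * k = 6 * k := by push_cast; ring
    have h43 : 4 * ((3 : ℕ) : ℂ) = 12 := by norm_num
    rw [hr, h23, h43, qTwelfth, mul_assoc, mul_comm (exp _)]
  exact key ▸ hs.hasSum

/-- The circle `‖u‖ = |q|^{1/2}` avoids the powers of `q`. -/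
lemma ne_zpow_of_norm_eq {u : ℂ} (hu : ‖u‖ = ‖qHalf τ‖) (k : ℤ) : u ≠ qq τ ^ k := by
  intro h
  have hp : ‖qHalf τ‖ ^ 2 = ‖qq τ‖ := by rw [← norm_pow, qHalf_sq]
  have hlt : ‖qHalf τ‖ ≠ 1 := fun h ↦ by
    have hq := norm_qq_lt_one τ
    rw [← hp, h] at hq; norm_num at hq
  rw [h, norm_zpow, ← hp, ← zpow_natCast, ← zpow_mul] at hu
  have := zpow_right_injective₀ (norm_pos_iff.mpr (qHalf_ne_zero τ)) hlt
    (hu.trans (zpow_one _).symm)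
  push_cast at this
  omega

lemma exists_hasSum_finiteU :
    ∃ h : ZMod 6 → ℂ, ∀ u : ℂ, u ≠ 0 → (∀ k : ℤ, u ≠ qq τ ^ k) →
      HasSum (fun n : ℤ ↦ h n * qTwelfth τ n * u ^ n) (finiteU (qq τ) (qHalf τ) u) := by
  have hq0 := qq_ne_zero τ
  have hq := norm_qq_lt_one τ
  obtain ⟨c, hc⟩ := exists_hasSum_laurent
    (F := fun w ↦ limUnder (𝓝[≠] w) (finiteU (qq τ) (qHalf τ))) fun u hu ↦ by
      obtain ⟨g, hg, hfg⟩ := exists_analyticAt_finiteU τ hu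
      exact differentiableAt_limUnder hg hfg
  have hF : ∀ u : ℂ, u ≠ 0 → (∀ k : ℤ, u ≠ qq τ ^ k) →
      HasSum (fun n : ℤ ↦ c n * u ^ n) (finiteU (qq τ) (qHalf τ) u) := fun u hu hk ↦ by
    have := hc u hu
    rwa [((analyticAt_finiteU τ hu hk).continuousAt.tendsto.mono_left
      nhdsWithin_le_nhds).limUnder_eq] at this
  have hR : 0 < ‖qHalf τ‖ := norm_pos_iff.mpr (qHalf_ne_zero τ)
  have hrec : (fun n : ℤ ↦ c n * qq τ ^ n) = fun n ↦ (qq τ)⁻¹ ^ 3 * c (n + 6) := by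
    refine eq_of_hasSum_laurent (F := fun u ↦ finiteU (qq τ) (qHalf τ) (qq τ * u)) hR
      (fun u hu ↦ ?_) fun u hu ↦ ?_
    · have hu0 : u ≠ 0 := norm_pos_iff.mp (hu ▸ hR)
      have := hF (qq τ * u) (mul_ne_zero hq0 hu0) fun k hk ↦ ne_zpow_of_norm_eq τ hu (k - 1) (by
        rw [zpow_sub_one₀ hq0, ← hk]; field_simp)
      simpa only [mul_zpow, mul_assoc] using this
    · have hu0 : u ≠ 0 := norm_pos_iff.mp (hu ▸ hR)
      rw [finiteU_mul_left (qHalf_sq _) hq0 hq hu0]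
      have := ((Equiv.addRight (6 : ℤ)).hasSum_iff.mpr
        (hF u hu0 (ne_zpow_of_norm_eq τ hu))).mul_left ((qq τ)⁻¹ ^ 3 * u⁻¹ ^ 6)
      refine (congrArg (HasSum · _) (funext fun n ↦ ?_)).mp this
      rw [Function.comp_apply, Equiv.coe_addRight, zpow_add₀ hu0]
      norm_cast
      field_simp
  have hper : ∀ n : ℤ, c (n + 6) / qTwelfth τ (n + 6) = c n / qTwelfth τ n := fun n ↦ by
    have h1 : c (n + 6) = c n * qq τ ^ (n + 3) := by
      have := congrFun hrec n
      rw [zpow_add₀ hq0, ← mul_assoc, this]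
      norm_cast
      field_simp
    rw [h1, qTwelfth_add_six, mul_div_mul_right _ _ (zpow_ne_zero _ hq0)]
  refine ⟨fun r ↦ c r.val / qTwelfth τ r.val, fun u hu hk ↦ ?_⟩
  convert hF u hu hk using 3 with n
  have hn : c ((n : ZMod 6).val : ℤ) / qTwelfth τ ((n : ZMod 6).val : ℤ) = c n / qTwelfth τ n := by
    rw [ZMod.val_intCast]
    have hp : Function.Periodic (fun n ↦ c n / qTwelfth τ n) 6 := hper
    have := hp.int_mul (n / 6) (n % 6)
    simp only [mul_comm _ (6 : ℤ), Int.cast_id, Int.emod_add_mul_ediv] at this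
    exact this.symm
  exact (congrArg (fun x ↦ x * qTwelfth (τ : ℂ) n) hn).trans
    (div_mul_cancel₀ _ (qTwelfth_ne_zero _ _))

lemma qq_ne_zpow (hz : ∀ a b : ℤ, z ≠ (a : ℂ) * (τ : ℂ) + (b : ℂ)) (k : ℤ) :
    qq z ≠ qq τ ^ k := by
  intro h
  rw [qq, qq, ← exp_int_mul, exp_eq_exp_iff_exists_int] at h
  obtain ⟨n, hn⟩ := h
  refine hz k n (mul_left_cancel₀ two_pi_I_ne_zero ?_)
  rw [hn]
  ring

lemma ne_add_of_qq_ne_zpow (hz : ∀ k : ℤ, qq z ≠ qq τ ^ k) (a b : ℤ) :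
    z ≠ (a : ℂ) * (τ : ℂ) + (b : ℂ) := by
  rintro rfl
  refine hz a ?_
  rw [qq, qq, ← exp_int_mul, exp_eq_exp_iff_exists_int]
  exact ⟨b, by ring⟩

lemma exists_qq_eq {u : ℂ} (hu : u ≠ 0) : ∃ z, qq z = u :=
  ⟨log u / (2 * ↑Real.pi * I), by rw [qq, mul_div_cancel₀ _ two_pi_I_ne_zero, exp_log hu]⟩

lemma finiteU_qq : finiteU (qq τ) (qHalf τ) (qq z) =
    -2 * Psi11 τ z * phi31 τ z + 12 * mu 3 τ z := by
  rw [Psi11_eq, phi31_eq, mu_eq, finiteU]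

end Auxiliary

/-- There is a unique family of functions `H_r : ℍ → ℂ`, `r ∈ ℤ/6ℤ`, with
`−2 Ψ_{1,1}(τ,z) φ^{(3)}_1(τ,z) = −12 μ_{3,0}(τ,z) + ∑_{r mod 6} H_r(τ) θ_{3,r}(τ,z)`
for all `τ ∈ ℍ` and `z ∉ ℤτ + ℤ`. -/
theorem stmt_12 :
    ∃! H : ZMod 6 → UpperHalfPlane → ℂ,
      ∀ (τ : UpperHalfPlane) (z : ℂ), (∀ a b : ℤ, z ≠ (a : ℂ) * (τ : ℂ) + (b : ℂ)) →
        -2 * Psi11 (τ : ℂ) z * phi31 (τ : ℂ) z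
          = -12 * mu 3 (τ : ℂ) z +
            ∑ r : ZMod 6, H r τ * thetam 3 (r.val : ℤ) (τ : ℂ) z := by
  choose h hh using exists_hasSum_finiteU
  refine ⟨fun r τ ↦ h τ r, fun τ z hz ↦ ?_, fun H hH ↦ ?_⟩
  · have := (hh τ _ (qq_ne_zero z) (qq_ne_zpow τ z hz)).unique (hasSum_thetam τ z (h τ))
    rw [finiteU_qq] at this
    linear_combination this
  · funext r τ
    have hR : 0 < ‖qHalf τ‖ := norm_pos_iff.mpr (qHalf_ne_zero τ)
    have hcoeff : (fun n : ℤ ↦ H n τ * qTwelfth τ n) = fun n : ℤ ↦ h τ n * qTwelfth τ n := by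
      refine eq_of_hasSum_laurent (F := finiteU (qq τ) (qHalf τ)) hR (fun u hu ↦ ?_) fun u hu ↦
        hh τ u (norm_pos_iff.mp (hu ▸ hR)) (ne_zpow_of_norm_eq τ hu)
      obtain ⟨z, rfl⟩ := exists_qq_eq (norm_pos_iff.mp (hu ▸ hR))
      have := hH τ z (ne_add_of_qq_ne_zpow τ z (ne_zpow_of_norm_eq τ hu))
      rw [finiteU_qq, this, add_right_comm]
      simpa using hasSum_thetam τ z (H · τ)
    obtain ⟨n, rfl⟩ := ZMod.intCast_surjective r
    exact mul_right_cancel₀ (qTwelfth_ne_zero τ n) (congrFun hcoeff n)
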